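/- Let G be a finite group in which every real element is a 2-element. Then G has a normal Sylow 2-subgroup. -/

import Mathlib

/-- An element `x` of a group is *real* if it is conjugate to its inverse. -/
def IsRealEl (G : Type*) [Group G] (x : G) : Prop := ∃ g : G, g⁻¹ * x * g = x⁻¹

/-- The size of the conjugacy class of `x` in `G`. -/
noncomputable def clSize (G : Type*) [Group G] (x : G) : ℕ := Nat.card {y : G // IsConj x y}

/-- In a `p`-group `P`, if a proper subgroup `M` misses part of the conjugation-invariant set `D`,
then some element of `D ∩ P` outside `M` normalizes `D ∩ M`. -/
lemma IsPGroup.exists_mem_normalizer_inter {G : Type*} [Group G] [Finite G] {p : ℕ}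
    [Fact p.Prime] {P M : Subgroup G} (hP : IsPGroup p P) (hMP : M ≤ P) {D : Set G}
    (hD : ∀ g a : G, a ∈ D ↔ g * a * g⁻¹ ∈ D) (hne : ¬ D ∩ P ⊆ M) :
    ∃ x ∈ P, x ∈ D ∧ x ∉ M ∧ x ∈ Subgroup.normalizer (D ∩ M : Set G) := by
  obtain ⟨K, ⟨hMK, hKM⟩, hmax⟩ := Set.Finite.exists_maximal
    (s := {K : Subgroup P | M.subgroupOf P ≤ K ∧ ∀ y : P, (y : G) ∈ D → y ∈ K → (y : G) ∈ M})
    (Set.toFinite _) ⟨M.subgroupOf P, le_rfl, fun y _ hy => hy⟩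
  have hK : K < ⊤ := by
    refine lt_top_iff_ne_top.2 fun hK => hne ?_
    rintro a ⟨haD, haP⟩
    exact hKM ⟨a, haP⟩ haD (hK ▸ Subgroup.mem_top _)
  have hnil := hP.isNilpotent
  have hlt : K < Subgroup.normalizer K := Group.normalizerCondition_of_isNilpotent K hK
  have hex : ∃ x : P, (x : G) ∈ D ∧ x ∈ Subgroup.normalizer (K : Set P) ∧ (x : G) ∉ M := by
    by_contra! hcon
    exact hlt.not_ge (hmax ⟨hMK.trans hlt.le, hcon⟩ hlt.le)
  obtain ⟨x, hxD, hxK, hxM⟩ := hex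
  refine ⟨x, x.2, hxD, hxM, ?_⟩
  have hiff : ∀ a : G, a ∈ D ∩ M ↔ a ∈ D ∧ ∃ y ∈ K, (y : G) = a := by
    intro a
    constructor
    · rintro ⟨haD, haM⟩
      exact ⟨haD, ⟨a, hMP haM⟩, hMK haM, rfl⟩
    · rintro ⟨haD, y, hy, rfl⟩
      exact ⟨haD, hKM y haD hy⟩
  rw [Subgroup.mem_set_normalizer_iff]
  rw [Subgroup.mem_set_normalizer_iff] at hxK
  intro a
  rw [hiff, hiff, ← hD]
  refine and_congr_right fun _ => ⟨?_, ?_⟩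
  · rintro ⟨y, hy, rfl⟩
    exact ⟨x * y * x⁻¹, (hxK y).1 hy, rfl⟩
  · rintro ⟨y, hy, hya⟩
    refine ⟨x⁻¹ * y * x, (hxK _).2 ?_, ?_⟩
    · simpa [mul_assoc] using hy
    · simp [hya, mul_assoc]

/-- **Baer–Suzuki**: if any two elements of a conjugation-invariant set `D` generate a `p`-group,
then `D` is contained in every Sylow `p`-subgroup. -/
theorem Sylow.subset_of_isPGroup_closure_pair {G : Type*} [Group G] [Finite G] {p : ℕ}
    [Fact p.Prime] {D : Set G} (hD : ∀ g a : G, a ∈ D ↔ g * a * g⁻¹ ∈ D)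
    (hpair : ∀ a ∈ D, ∀ b ∈ D, IsPGroup p (Subgroup.closure {a, b})) (P : Sylow p G) :
    D ⊆ P := by
  have hcard : ∀ P Q : Sylow p G, D ∩ P ⊆ Q → D ∩ (P : Set G) = D ∩ Q := by
    intro P Q hPQ
    obtain ⟨g, rfl⟩ := MulAction.exists_smul_eq G P Q
    refine Set.eq_of_subset_of_ncard_le (Set.subset_inter Set.inter_subset_left hPQ) ?_
      (Set.toFinite _)
    refine Set.ncard_le_ncard_of_injOn (fun a => g⁻¹ * a * g) ?_ ?_ (Set.toFinite _)
    · rintro a ⟨haD, haP⟩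
      refine ⟨by simpa using (hD g⁻¹ a).1 haD, ?_⟩
      rw [Sylow.coe_smul, Set.mem_smul_set_iff_inv_smul_mem] at haP
      simpa [MulAut.smul_def, ← map_inv] using haP
    · intro a _ b _ hab
      simpa using hab
  have key : ∀ P Q : Sylow p G, D ∩ (P : Set G) = D ∩ Q := by
    by_contra! hcon
    obtain ⟨P₀, Q₀, h₀⟩ := hcon
    obtain ⟨⟨P, Q⟩, hPQ, hmax⟩ := Set.exists_max_image
      {R : Sylow p G × Sylow p G | D ∩ (R.1 : Set G) ≠ D ∩ R.2}
      (fun R => (D ∩ ((R.1 ⊓ R.2 : Subgroup G) : Set G)).ncard) (Set.toFinite _) ⟨(P₀, Q₀), h₀⟩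
    change D ∩ (P : Set G) ≠ D ∩ Q at hPQ
    have step : ∀ P' R : Sylow p G, (P ⊓ Q : Subgroup G) ≤ P' →
        D ∩ ((P ⊓ Q : Subgroup G) : Set G) ⊆ R →
        (∃ x ∈ P', x ∈ D ∧ x ∉ (P ⊓ Q : Subgroup G) ∧ x ∈ R) →
        D ∩ (P' : Set G) = D ∩ R := by
      rintro P' R hP' hR ⟨x, hxP, hxD, hx, hxR⟩
      by_contra hne
      refine (hmax (P', R) hne).not_gt (Set.ncard_lt_ncard ?_ (Set.toFinite _))
      refine ⟨fun a ha => ⟨ha.1, hP' ha.2, hR ha⟩, fun hsub => hx (hsub ⟨hxD, hxP, hxR⟩).2⟩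
    obtain ⟨x, hxP, hxD, hx, hxN⟩ := P.2.exists_mem_normalizer_inter
      (M := P ⊓ Q) inf_le_left hD (fun h => hPQ (hcard P Q fun a ha => (h ha).2))
    obtain ⟨y, hyQ, hyD, hy, hyN⟩ := Q.2.exists_mem_normalizer_inter
      (M := P ⊓ Q) inf_le_right hD (fun h => hPQ (hcard Q P fun a ha => (h ha).1).symm)
    have hle : Subgroup.closure {x, y} ≤
        Subgroup.normalizer (Subgroup.closure (D ∩ ((P ⊓ Q : Subgroup G) : Set G))) := by
      rw [Subgroup.closure_le]
      rintro z (rfl | rfl)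
      · exact Subgroup.normalizer_le_normalizer_closure _ hxN
      · exact Subgroup.normalizer_le_normalizer_closure _ hyN
    have hE : IsPGroup p (Subgroup.closure (D ∩ ((P ⊓ Q : Subgroup G) : Set G))) :=
      P.2.to_le ((Subgroup.closure_le _).2 fun a ha => ha.2.1)
    obtain ⟨R, hR⟩ := ((hpair x hxD y hyD).to_sup_of_normal_right' hE hle).exists_le_sylow
    have hER : D ∩ ((P ⊓ Q : Subgroup G) : Set G) ⊆ R :=
      fun a ha => hR (Subgroup.mem_sup_right (Subgroup.subset_closure ha))
    have hxR : x ∈ R := hR (Subgroup.mem_sup_left (Subgroup.subset_closure (by simp)))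
    have hyR : y ∈ R := hR (Subgroup.mem_sup_left (Subgroup.subset_closure (by simp)))
    exact hPQ ((step P R inf_le_left hER ⟨x, hxP, hxD, hx, hxR⟩).trans
      (step Q R inf_le_right hER ⟨y, hyQ, hyD, hy, hyR⟩).symm)
  intro a ha
  obtain ⟨Q, hQ⟩ := (hpair a ha a ha).exists_le_sylow
  have haQ : a ∈ D ∩ (Q : Set G) := ⟨ha, hQ (Subgroup.subset_closure (by simp))⟩
  exact (key P Q ▸ haQ).2

lemma IsPGroup.zpowers_of_pow_eq_one {G : Type*} [Group G] {p k : ℕ} [Fact p.Prime] {x : G}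
    (hx : x ^ p ^ k = 1) : IsPGroup p (Subgroup.zpowers x) :=
  IsPGroup.of_card_dvd_pow (n := k) (by rw [Nat.card_zpowers]; exact orderOf_dvd_of_pow_eq_one hx)

/-- Two involutions whose product is a `2`-element generate a `2`-group. -/
lemma isPGroup_two_closure_pair {G : Type*} [Group G] {a b : G} (ha : a * a = 1) (hb : b * b = 1)
    {k : ℕ} (hab : orderOf (a * b) = 2 ^ k) : IsPGroup 2 (Subgroup.closure {a, b}) := by
  have ha' : a⁻¹ = a := inv_eq_of_mul_eq_one_left ha
  have hb' : b⁻¹ = b := inv_eq_of_mul_eq_one_left hb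
  have hz : IsPGroup 2 (Subgroup.zpowers (a * b)) :=
    IsPGroup.zpowers_of_pow_eq_one (k := k) (hab ▸ pow_orderOf_eq_one _)
  have h2 : IsPGroup 2 (Subgroup.zpowers a) :=
    IsPGroup.zpowers_of_pow_eq_one (k := 1) (by simpa [pow_two] using ha)
  have hconj : MulAut.conj a (a * b) = (a * b)⁻¹ := by
    simp [ha', hb', ← mul_assoc, ha]
  have hN : Subgroup.zpowers a ≤ Subgroup.normalizer (Subgroup.zpowers (a * b)) := by
    rw [Subgroup.zpowers_le, Subgroup.mem_normalizer_iff_map_conj_eq]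
    rw [MonoidHom.map_zpowers]
    simp only [MonoidHom.coe_coe, hconj, Subgroup.zpowers_inv]
  refine (h2.to_sup_of_normal_right' hz hN).to_le ((Subgroup.closure_le _).2 ?_)
  rintro z (rfl | rfl)
  · exact Subgroup.mem_sup_left (Subgroup.mem_zpowers _)
  · have := mul_mem (Subgroup.mem_sup_left (T := Subgroup.zpowers (a * z))
      (Subgroup.mem_zpowers a)) (Subgroup.mem_sup_right (Subgroup.mem_zpowers (a * z)))
    simpa [← mul_assoc, ha] using this

lemma IsRealEl.pow {G : Type*} [Group G] {x : G} (hx : IsRealEl G x) (n : ℕ) :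
    IsRealEl G (x ^ n) := by
  obtain ⟨g, hg⟩ := hx
  refine ⟨g, ?_⟩
  have := conj_pow (i := n) (a := g⁻¹) (b := x)
  rw [inv_inv] at this
  rw [← this, hg, inv_pow]

/-- A `p`-element is real as soon as it is real modulo a normal `q`-subgroup, `q ≠ p`. -/
lemma IsRealEl.of_quotient {G : Type*} [Group G] [Finite G] {p q k : ℕ} [Fact p.Prime]
    [Fact q.Prime] (hpq : p ≠ q) {N : Subgroup G} [N.Normal] (hN : IsPGroup q N) {x : G}
    (hx : x ^ p ^ k = 1) (hreal : IsRealEl (G ⧸ N) (x : G ⧸ N)) : IsRealEl G x := by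
  obtain ⟨g', hg⟩ := hreal
  obtain ⟨g, rfl⟩ := QuotientGroup.mk_surjective g'
  let H : Subgroup G := (Subgroup.zpowers (x : G ⧸ N)).comap (QuotientGroup.mk' N)
  have hxH : x ∈ H := Subgroup.mem_zpowers (x : G ⧸ N)
  have hyH : g⁻¹ * x * g ∈ H := by
    change (g : G ⧸ N)⁻¹ * x * g ∈ Subgroup.zpowers (x : G ⧸ N)
    rw [hg]
    exact inv_mem (Subgroup.mem_zpowers _)
  let x' : H := ⟨x, hxH⟩
  let y' : H := ⟨g⁻¹ * x * g, hyH⟩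
  have hx' : x' ^ p ^ k = 1 := Subtype.ext hx
  have hy' : y' ^ p ^ k = 1 := by
    refine Subtype.ext ?_
    have := conj_pow (i := p ^ k) (a := g⁻¹) (b := x)
    rw [inv_inv] at this
    simp [y', this, hx]
  obtain ⟨P, hP⟩ := (IsPGroup.zpowers_of_pow_eq_one hx').exists_le_sylow
  obtain ⟨Q, hQ⟩ := (IsPGroup.zpowers_of_pow_eq_one hy').exists_le_sylow
  obtain ⟨h, rfl⟩ := MulAction.exists_smul_eq H P Q
  have hxP : x' ∈ P := hP (Subgroup.mem_zpowers _)
  have hyP : h⁻¹ * y' * h ∈ P := by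
    have : y' ∈ ((h • P : Sylow p H) : Set H) := hQ (Subgroup.mem_zpowers _)
    rw [Sylow.coe_smul, Set.mem_smul_set_iff_inv_smul_mem] at this
    simpa [MulAut.smul_def, ← map_inv] using this
  have hcomm : Commute ((h : G) : G ⧸ N) (x : G ⧸ N) := by
    obtain ⟨n, hn⟩ := h.2
    rw [show ((h : G) : G ⧸ N) = (x : G ⧸ N) ^ n from hn.symm]
    exact (Commute.refl _).zpow_left n
  have hmem : (h⁻¹ * y' * h * x' : H) ∈ N.subgroupOf H := by
    rw [Subgroup.mem_subgroupOf, ← QuotientGroup.eq_one_iff]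
    change ((h : G) : G ⧸ N)⁻¹ * ((g : G ⧸ N)⁻¹ * x * g) * (h : G) * x = 1
    rw [hg, (hcomm.inv_left.inv_right).eq]
    simp
  have hdisj := IsPGroup.disjoint_of_ne p q hpq _ _ P.2 (hN.comap_subtype (K := H))
  have h1 : h⁻¹ * y' * h * x' = 1 := Subgroup.disjoint_def.1 hdisj (mul_mem hyP hxP) hmem
  refine ⟨g * h, ?_⟩
  have h2 := congrArg (Subtype.val) (eq_inv_of_mul_eq_one_left h1)
  simpa [x', y', mul_assoc] using h2

/-- The property that all real elements are `2`-elements passes to quotients by normal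
`2`-subgroups. -/
lemma IsRealEl.orderOf_quotient {G : Type*} [Group G] [Finite G]
    (h : ∀ x : G, IsRealEl G x → ∃ k : ℕ, orderOf x = 2 ^ k) {N : Subgroup G} [N.Normal]
    (hN : IsPGroup 2 N) (x : G ⧸ N) (hx : IsRealEl (G ⧸ N) x) : ∃ k : ℕ, orderOf x = 2 ^ k := by
  refine ⟨_, Nat.eq_prime_pow_of_unique_prime_dvd (orderOf_pos x).ne' fun {p} hp hpx => ?_⟩
  by_contra hp2
  have : Fact p.Prime := ⟨hp⟩
  obtain ⟨y, rfl⟩ := QuotientGroup.mk_surjective x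
  have hy0 := (orderOf_pos y).ne'
  set m := ordCompl[p] (orderOf y) with hm
  have hpow : (y ^ m) ^ p ^ (orderOf y).factorization p = 1 := by
    rw [← pow_mul, mul_comm, hm, Nat.ordProj_mul_ordCompl_eq_self, pow_orderOf_eq_one]
  have hreal : IsRealEl G (y ^ m) := IsRealEl.of_quotient hp2 hN hpow (hx.pow m)
  obtain ⟨k, hk⟩ := h _ hreal
  have hone : y ^ m = 1 := by
    refine orderOf_eq_one_iff.1 (Nat.eq_one_of_dvd_coprimes
      (((Nat.coprime_primes hp Nat.prime_two).2 hp2).pow _ k)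
      (orderOf_dvd_of_pow_eq_one hpow) (dvd_of_eq hk))
  have hdvd : orderOf (y : G ⧸ N) ∣ m := by
    refine orderOf_dvd_of_pow_eq_one ?_
    rw [← QuotientGroup.mk_pow, hone, QuotientGroup.mk_one]
  exact Nat.not_dvd_ordCompl hp hy0 (hpx.trans hdvd)

/-- If all real elements are `2`-elements, every Sylow `2`-subgroup contains all involutions. -/
lemma Sylow.mem_of_mul_self_eq_one {G : Type*} [Group G] [Finite G]
    (h : ∀ x : G, IsRealEl G x → ∃ k : ℕ, orderOf x = 2 ^ k) (P : Sylow 2 G) {a : G}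
    (ha : a * a = 1) : a ∈ P := by
  refine Sylow.subset_of_isPGroup_closure_pair (D := {a : G | a * a = 1}) ?_ ?_ P ha
  · intro g a
    rw [Set.mem_ofPred_eq, Set.mem_ofPred_eq, conj_mul, conj_eq_one_iff]
  · intro a ha b hb
    have ha' : a⁻¹ = a := inv_eq_of_mul_eq_one_left ha
    have hb' : b⁻¹ = b := inv_eq_of_mul_eq_one_left hb
    obtain ⟨k, hk⟩ := h (a * b) ⟨a, by rw [mul_inv_rev, ha', hb', ← mul_assoc, show a * a = 1 from ha, one_mul]⟩
    exact isPGroup_two_closure_pair ha hb hk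

theorem stmt_11 {G : Type*} [Group G] [Finite G]
    (h : ∀ x : G, IsRealEl G x → ∃ k : ℕ, orderOf x = 2 ^ k) :
    ∀ P : Sylow 2 G, (P : Subgroup G).Normal := by
  induction hn : Nat.card G using Nat.strong_induction_on generalizing G with
  | _ n ih =>
  intro P
  let N : Subgroup G := Subgroup.normalClosure {a : G | a * a = 1}
  have hNP : N ≤ P := by
    refine (Subgroup.closure_le _).2 fun a ha => ?_
    obtain ⟨b, hb, hba⟩ := Group.mem_conjugatesOfSet_iff.1 ha
    obtain ⟨c, rfl⟩ := isConj_iff.1 hba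
    refine P.mem_of_mul_self_eq_one h ?_
    rw [conj_mul, show b * b = 1 from hb]
    simp
  have hN2 : IsPGroup 2 N := P.2.to_le hNP
  by_cases hN : N = ⊥
  · have hP : (P : Subgroup G) = ⊥ := by
      by_contra hne
      have : Nontrivial P := (Subgroup.nontrivial_iff_ne_bot _).2 hne
      have hdvd : 2 ∣ Nat.card P :=
        P.2.card_eq_or_dvd.resolve_left Finite.one_lt_card.ne'
      obtain ⟨x, hx⟩ := exists_prime_orderOf_dvd_card' 2 hdvd
      have hxN : (x : G) ∈ N := Subgroup.subset_normalClosure (by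
        have := pow_orderOf_eq_one x
        rw [hx, pow_two] at this
        exact congrArg Subtype.val this)
      rw [hN, Subgroup.mem_bot, OneMemClass.coe_eq_one] at hxN
      simp [hxN] at hx
    rw [hP]
    infer_instance
  · have hlt : Nat.card (G ⧸ N) < n := by
      rw [← hn, N.card_eq_card_quotient_mul_card_subgroup]
      have : Nontrivial N := (Subgroup.nontrivial_iff_ne_bot _).2 hN
      exact lt_mul_of_one_lt_right Nat.card_pos Finite.one_lt_card
    have hnormal := ih _ hlt (IsRealEl.orderOf_quotient h hN2) rfl
      (P.mapSurjective (QuotientGroup.mk'_surjective N))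
    rw [Sylow.coe_mapSurjective] at hnormal
    have := hnormal.comap (QuotientGroup.mk' N)
    rwa [Subgroup.comap_map_eq_self (by rwa [QuotientGroup.ker_mk'])] at this
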